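/- Let g be the 5-dimensional direct product Lie algebra sl(2,ℝ) ⊕ s_{2,1}, where sl(2,ℝ) is the Lie algebra of traceless real 2×2 matrices and s_{2,1} is the 2-dimensional nonabelian Lie algebra ℝ² with the only nonzero bracket [f1,f2] = f2. Then for every nondegenerate symmetric bilinear form B on g, the Lie bracket of g is NOT in the null cone of the O(B)-action; that is, 0 does not lie in the closure of the orbit O(B)·μ for the bracket μ of g. -/

import Mathlib

/-- The isometry group `O(B)` of a bilinear form `B`. -/
def IsometryGrp {V : Type*} [AddCommGroup V] [Module ℝ V]
    (B : LinearMap.BilinForm ℝ V) : Set (V ≃ₗ[ℝ] V) :=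
  {A | ∀ x y, B (A x) (A y) = B x y}

/-- `μ` is in the null cone of the `O(B)`-action: `0` lies in the closure of the orbit
`O(B)·μ`, `(A·μ)(x,y) = A⁻¹(μ(Ax,Ay))`, in the topology of pointwise convergence. -/
def InNullCone {V : Type*} [AddCommGroup V] [Module ℝ V] [TopologicalSpace V]
    (B : LinearMap.BilinForm ℝ V) (μ : V → V → V) : Prop :=
  (0 : V → V → V) ∈
    closure {f : V → V → V | ∃ A ∈ IsometryGrp B, f = fun x y => A.symm (μ (A x) (A y))}

/-- The bracket of the direct product Lie algebra `sl(2,ℝ) ⊕ s_{2,1}`, where `sl(2,ℝ)` is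
the Lie algebra of traceless real `2×2` matrices and `s_{2,1}` is `ℝ²` with the only
nonzero bracket `[f1,f2] = f2` (so `[u,v] = (u 0 * v 1 − u 1 * v 0) • f2`). -/
def sl2SumS21Bracket :
    (LieAlgebra.SpecialLinear.sl (Fin 2) ℝ × (Fin 2 → ℝ)) →
    (LieAlgebra.SpecialLinear.sl (Fin 2) ℝ × (Fin 2 → ℝ)) →
    (LieAlgebra.SpecialLinear.sl (Fin 2) ℝ × (Fin 2 → ℝ)) :=
  fun a b => (⁅a.1, b.1⁆, ![0, a.2 0 * b.2 1 - a.2 1 * b.2 0])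

open Matrix

/-- The ambient vector space. -/
abbrev SV : Type := LieAlgebra.SpecialLinear.sl (Fin 2) ℝ × (Fin 2 → ℝ)

/-- Coordinates with respect to the basis `h, e+f, e-f, f1, f2`. -/
noncomputable def svEquiv : SV ≃ₗ[ℝ] (Fin 5 → ℝ) where
  toFun a := ![a.1.1 0 0, (a.1.1 0 1 + a.1.1 1 0) / 2, (a.1.1 0 1 - a.1.1 1 0) / 2, a.2 0, a.2 1]
  invFun c := (⟨!![c 0, c 1 + c 2; c 1 - c 2, - c 0], by
    change _ ∈ LinearMap.ker (Matrix.traceLinearMap (Fin 2) ℝ ℝ)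
    simp [Matrix.trace_fin_two]⟩, ![c 3, c 4])
  map_add' a b := by
    ext i; fin_cases i <;> simp <;> ring
  map_smul' r a := by
    ext i; fin_cases i <;> simp <;> ring
  left_inv a := by
    obtain ⟨⟨m, hm⟩, u⟩ := a
    have ht : m 0 0 + m 1 1 = 0 := by
      change m ∈ LinearMap.ker (Matrix.traceLinearMap (Fin 2) ℝ ℝ) at hm
      simpa [Matrix.trace_fin_two] using hm
    refine Prod.ext (Subtype.ext ?_) ?_
    · ext i j; fin_cases i <;> fin_cases j <;> simp <;> linarith
    · ext i; fin_cases i <;> simp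
  right_inv c := by
    ext i; fin_cases i <;> simp

/-- The basis. -/
noncomputable def svBasis : Module.Basis (Fin 5) ℝ SV := Module.Basis.ofEquivFun svEquiv

lemma continuous_svEquiv : Continuous (fun a : SV => svEquiv a) := by
  have h1 : Continuous fun a : SV => a.1.1 := continuous_subtype_val.comp continuous_fst
  have h2 : ∀ i j, Continuous fun a : SV => a.1.1 i j := fun i j =>
    (continuous_apply j).comp ((continuous_apply i).comp h1)
  have h3 : ∀ i, Continuous fun a : SV => a.2 i := fun i =>
    (continuous_apply i).comp continuous_snd
  refine continuous_pi fun i => ?_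
  fin_cases i
  · exact h2 0 0
  · exact ((h2 0 1).add (h2 1 0)).div_const 2
  · exact ((h2 0 1).sub (h2 1 0)).div_const 2
  · exact h3 0
  · exact h3 1

/-- Adjoint matrices of a bracket. -/
noncomputable def adMat (f : SV → SV → SV) (i : Fin 5) : Matrix (Fin 5) (Fin 5) ℝ :=
  Matrix.of fun k l => svEquiv (f (svBasis i) (svBasis l)) k

/-- Killing matrix of a bracket. -/
noncomputable def kilMat (f : SV → SV → SV) : Matrix (Fin 5) (Fin 5) ℝ :=
  Matrix.of fun i j => Matrix.trace (adMat f i * adMat f j)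

lemma continuous_adMat (i : Fin 5) : Continuous fun f => adMat f i := by
  refine continuous_matrix fun k l => ?_
  exact (continuous_apply k).comp (continuous_svEquiv.comp
    ((continuous_apply (svBasis l)).comp (continuous_apply (svBasis i))))

lemma continuous_kilMat : Continuous kilMat := by
  refine continuous_matrix fun i j => ?_
  exact ((continuous_adMat i).matrix_mul (continuous_adMat j)).matrix_trace

/-- The bracket as a linear map. -/
noncomputable def adLin : SV →ₗ[ℝ] SV →ₗ[ℝ] SV :=
  LinearMap.mk₂ ℝ sl2SumS21Bracket
    (by
      intro a b c; refine Prod.ext ?_ ?_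
      · simp [sl2SumS21Bracket]
      · ext i; fin_cases i <;> simp [sl2SumS21Bracket]; ring)
    (by
      intro r a c; refine Prod.ext ?_ ?_
      · simp [sl2SumS21Bracket]
      · ext i; fin_cases i <;> simp [sl2SumS21Bracket]; ring)
    (by
      intro a b c; refine Prod.ext ?_ ?_
      · simp [sl2SumS21Bracket]
      · ext i; fin_cases i <;> simp [sl2SumS21Bracket]; ring)
    (by
      intro r a c; refine Prod.ext ?_ ?_
      · simp [sl2SumS21Bracket]
      · ext i; fin_cases i <;> simp [sl2SumS21Bracket]; ring)

/-- The Killing form. -/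
noncomputable def kil : LinearMap.BilinForm ℝ SV :=
  LinearMap.mk₂ ℝ (fun x y => LinearMap.trace ℝ SV (adLin x * adLin y))
    (by intro a b c; simp [add_mul]) (by intro a b c; simp)
    (by intro a b c; simp [mul_add]) (by intro a b c; simp)

lemma kilMat_orbit (A : SV ≃ₗ[ℝ] SV) :
    kilMat (fun x y => A.symm (sl2SumS21Bracket (A x) (A y))) =
      Matrix.of fun i j => kil (A (svBasis i)) (A (svBasis j)) := by
  have h : ∀ i, adMat (fun x y => A.symm (sl2SumS21Bracket (A x) (A y))) i =
      LinearMap.toMatrix svBasis svBasis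
        (A.symm.toLinearMap ∘ₗ adLin (A (svBasis i)) ∘ₗ A.toLinearMap) := by
    intro i
    ext k l
    rw [LinearMap.toMatrix_apply]
    rfl
  ext i j
  simp only [kilMat, Matrix.of_apply, h]
  rw [← LinearMap.toMatrix_comp, ← LinearMap.trace_eq_matrix_trace]
  have e : (A.symm.toLinearMap ∘ₗ adLin (A (svBasis i)) ∘ₗ A.toLinearMap) ∘ₗ
      (A.symm.toLinearMap ∘ₗ adLin (A (svBasis j)) ∘ₗ A.toLinearMap) =
      A.symm.conj (adLin (A (svBasis i)) * adLin (A (svBasis j))) := by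
    refine LinearMap.ext fun x => ?_
    simp [LinearEquiv.conj_apply]
  rw [e, LinearMap.trace_conj']
  rfl

lemma toMatrix_comp_equiv (C : LinearMap.BilinForm ℝ SV) (A : SV ≃ₗ[ℝ] SV) :
    (Matrix.of fun i j => C (A (svBasis i)) (A (svBasis j))) =
      (LinearMap.toMatrix svBasis svBasis A.toLinearMap)ᵀ * LinearMap.BilinForm.toMatrix svBasis C *
        LinearMap.toMatrix svBasis svBasis A.toLinearMap := by
  rw [← LinearMap.BilinForm.toMatrix_comp]
  ext i j
  simp [LinearMap.BilinForm.toMatrix_apply]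

set_option maxHeartbeats 2000000 in
lemma kilMat_bracket : kilMat sl2SumS21Bracket = Matrix.diagonal ![8, 8, -8, 1, 0] := by
  have hb : ∀ i, svBasis i = svEquiv.symm (Pi.single i 1) := fun i => by
    simp [svBasis]
  have h0 : adMat sl2SumS21Bracket 0 =
      !![0,0,0,0,0; 0,0,2,0,0; 0,2,0,0,0; 0,0,0,0,0; 0,0,0,0,0] := by
    ext k l
    fin_cases k <;> fin_cases l <;>
      simp [adMat, hb, svEquiv, sl2SumS21Bracket, Ring.lie_def,
        LieSubalgebra.coe_bracket] <;> norm_num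
  have h1 : adMat sl2SumS21Bracket 1 =
      !![0,0,-2,0,0; 0,0,0,0,0; -2,0,0,0,0; 0,0,0,0,0; 0,0,0,0,0] := by
    ext k l
    fin_cases k <;> fin_cases l <;>
      simp [adMat, hb, svEquiv, sl2SumS21Bracket, Ring.lie_def,
        LieSubalgebra.coe_bracket] <;> norm_num
  have h2 : adMat sl2SumS21Bracket 2 =
      !![0,2,0,0,0; -2,0,0,0,0; 0,0,0,0,0; 0,0,0,0,0; 0,0,0,0,0] := by
    ext k l
    fin_cases k <;> fin_cases l <;>
      simp [adMat, hb, svEquiv, sl2SumS21Bracket, Ring.lie_def,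
        LieSubalgebra.coe_bracket] <;> norm_num
  have h3 : adMat sl2SumS21Bracket 3 =
      !![0,0,0,0,0; 0,0,0,0,0; 0,0,0,0,0; 0,0,0,0,0; 0,0,0,0,1] := by
    ext k l
    fin_cases k <;> fin_cases l <;>
      simp [adMat, hb, svEquiv, sl2SumS21Bracket, Ring.lie_def,
        LieSubalgebra.coe_bracket]
  have h4 : adMat sl2SumS21Bracket 4 =
      !![0,0,0,0,0; 0,0,0,0,0; 0,0,0,0,0; 0,0,0,0,0; 0,0,0,-1,0] := by
    ext k l
    fin_cases k <;> fin_cases l <;>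
      simp [adMat, hb, svEquiv, sl2SumS21Bracket, Ring.lie_def,
        LieSubalgebra.coe_bracket]
  ext i j
  fin_cases i <;> fin_cases j <;>
    simp [kilMat, h0, h1, h2, h3, h4, Matrix.trace, Fin.sum_univ_succ] <;> norm_num

/-- A nilpotent `G`-self-adjoint matrix cannot have associated form of signature `(3,1)`. -/
lemma no_nilpotent (G N : Matrix (Fin 5) (Fin 5) ℝ) (hG : Gᵀ = G)
    (hGN : G * N = Matrix.diagonal ![8, 8, -8, 1, 0]) (hdet : IsUnit G.det)
    (hN : N ^ 5 = 0) : False := by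
  set D : Matrix (Fin 5) (Fin 5) ℝ := Matrix.diagonal ![8, 8, -8, 1, 0] with hD
  have hsym : Nᵀ * G = G * N := by
    have := congrArg Matrix.transpose hGN
    rw [Matrix.transpose_mul, hG] at this
    rw [this, hGN, hD, Matrix.diagonal_transpose]
  have hiso : (N * N)ᵀ * D * (N * N) = 0 := by
    have h1 : (N * N)ᵀ * D * (N * N) = G * N ^ 5 := by
      calc (N * N)ᵀ * D * (N * N) = Nᵀ * (Nᵀ * G) * N * (N * N) := by
            rw [← hGN, Matrix.transpose_mul]; simp only [Matrix.mul_assoc]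
        _ = (Nᵀ * G) * N * N * (N * N) := by simp only [hsym, ← Matrix.mul_assoc]
        _ = G * N ^ 5 := by rw [hsym]; simp only [pow_succ, pow_zero, one_mul, Matrix.mul_assoc]
    rw [h1, hN, mul_zero]
  have hker : ∀ x, N *ᵥ x = 0 → x 4 = 0 → x = 0 := by
    intro x hx h4
    have h : D *ᵥ x = 0 := by rw [← hGN, ← Matrix.mulVec_mulVec, hx, Matrix.mulVec_zero]
    have hi := fun i => congrFun h i
    simp only [hD, Matrix.mulVec_diagonal] at hi
    ext i
    have := hi i
    fin_cases i <;> simp_all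
  let ψ : (Fin 5 → ℝ) →ₗ[ℝ] (Fin 4 → ℝ) := LinearMap.pi
    ![LinearMap.proj 2 ∘ₗ (N * N).mulVecLin, LinearMap.proj 4 ∘ₗ (N * N).mulVecLin,
      LinearMap.proj 4 ∘ₗ N.mulVecLin, LinearMap.proj 4]
  have hψ : Function.Injective ψ := by
    rw [← LinearMap.ker_eq_bot, LinearMap.ker_eq_bot']
    intro x hx
    have a0 : ((N * N) *ᵥ x) 2 = 0 := congrFun hx 0
    have a1 : ((N * N) *ᵥ x) 4 = 0 := congrFun hx 1
    have a2 : (N *ᵥ x) 4 = 0 := congrFun hx 2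
    have a3 : x 4 = 0 := congrFun hx 3
    have hq : ((N * N) *ᵥ x) ⬝ᵥ (D *ᵥ ((N * N) *ᵥ x)) = 0 := by
      have : x ⬝ᵥ (((N * N)ᵀ * D * (N * N)) *ᵥ x) = 0 := by rw [hiso]; simp
      rw [← this, Matrix.mul_assoc, ← Matrix.mulVec_mulVec x (N * N)ᵀ,
        ← Matrix.mulVec_mulVec x D, Matrix.dotProduct_mulVec x, Matrix.vecMul_transpose]
    have hNN : (N * N) *ᵥ x = 0 := by
      generalize (N * N) *ᵥ x = y at *
      simp only [dotProduct, hD, Matrix.mulVec_diagonal, Fin.sum_univ_five] at hq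
      simp [a0, a1] at hq
      have b0 : y 0 = 0 := by nlinarith [sq_nonneg (y 0), sq_nonneg (y 1), sq_nonneg (y 3)]
      have b1 : y 1 = 0 := by nlinarith [sq_nonneg (y 0), sq_nonneg (y 1), sq_nonneg (y 3)]
      have b3 : y 3 = 0 := by nlinarith [sq_nonneg (y 0), sq_nonneg (y 1), sq_nonneg (y 3)]
      ext i; fin_cases i <;> simp [*]
    rw [← Matrix.mulVec_mulVec] at hNN
    exact hker x (hker _ hNN a2) a3
  have := LinearMap.finrank_le_finrank_of_injective hψ
  simp at this

/-- For every nondegenerate symmetric bilinear form `B` on `sl(2,ℝ) ⊕ s_{2,1}`, the Lie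
bracket of `sl(2,ℝ) ⊕ s_{2,1}` is NOT in the null cone of the `O(B)`-action. -/
theorem sl2_sum_s21_not_in_null_cone
    (B : LinearMap.BilinForm ℝ (LieAlgebra.SpecialLinear.sl (Fin 2) ℝ × (Fin 2 → ℝ)))
    (hBnd : ∀ x, (∀ y, B x y = 0) → x = 0)
    (hBsymm : ∀ x y, B x y = B y x) :
    ¬ InNullCone B sl2SumS21Bracket := by
  intro hnull
  set G := LinearMap.BilinForm.toMatrix svBasis B with hGdef
  have hGsymm : Gᵀ = G := by
    ext i j
    simp [hGdef, LinearMap.BilinForm.toMatrix_apply, hBsymm (svBasis j)]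
  have hGdet : G.det ≠ 0 := by
    refine (LinearMap.BilinForm.nondegenerate_iff_det_ne_zero svBasis).1 ?_
    refine ⟨fun x hx => hBnd x hx, fun x hx => hBnd x fun y => ?_⟩
    rw [hBsymm]; exact hx y
  have hkil : LinearMap.BilinForm.toMatrix svBasis kil = kilMat sl2SumS21Bracket := by
    have := kilMat_orbit (LinearEquiv.refl ℝ SV)
    simp only [LinearEquiv.refl_symm, LinearEquiv.refl_apply] at this
    rw [this]
    ext i j
    simp [LinearMap.BilinForm.toMatrix_apply]
  set D := kilMat sl2SumS21Bracket with hD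
  have key : ∀ t : ℝ, (t • G - D).det = (t • G).det := by
    intro t
    have hcl : IsClosed {f : SV → SV → SV | (t • G - kilMat f).det = (t • G - D).det} :=
      isClosed_eq (continuous_const.sub continuous_kilMat).matrix_det continuous_const
    have hsub : {f : SV → SV → SV | ∃ A ∈ IsometryGrp B,
        f = fun x y => A.symm (sl2SumS21Bracket (A x) (A y))} ⊆
        {f : SV → SV → SV | (t • G - kilMat f).det = (t • G - D).det} := by
      rintro f ⟨A, hA, rfl⟩
      set P := LinearMap.toMatrix svBasis svBasis A.toLinearMap with hP
      have hPG : Pᵀ * G * P = G := by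
        rw [hP, hGdef, ← toMatrix_comp_equiv]
        ext i j
        simp only [Matrix.of_apply, LinearMap.BilinForm.toMatrix_apply]
        exact hA _ _
      have hPD : kilMat (fun x y => A.symm (sl2SumS21Bracket (A x) (A y))) = Pᵀ * D * P := by
        rw [kilMat_orbit, toMatrix_comp_equiv, hkil]
      have hdet : P.det * P.det = 1 := by
        have := congrArg Matrix.det hPG
        rw [Matrix.det_mul, Matrix.det_mul, Matrix.det_transpose] at this
        have h2 : (P.det * P.det - 1) * G.det = 0 := by linear_combination this
        have := (mul_eq_zero.1 h2).resolve_right hGdet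
        linarith
      have e : t • G - Pᵀ * D * P = Pᵀ * (t • G - D) * P := by
        rw [Matrix.mul_sub, Matrix.sub_mul, Matrix.mul_smul, Matrix.smul_mul, hPG]
      change (t • G - kilMat _).det = _
      rw [hPD, e, Matrix.det_mul, Matrix.det_mul, Matrix.det_transpose]
      linear_combination (t • G - D).det * hdet
    have h0 := closure_minimal hsub hcl hnull
    have hk0 : kilMat 0 = 0 := by
      ext i j
      have : ∀ i, adMat 0 i = 0 := fun i => by ext k l; simp [adMat]
      simp [kilMat, this]
    simp only [Set.mem_ofPred_eq, hk0, sub_zero] at h0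
    exact h0.symm
  have hu : IsUnit G.det := isUnit_iff_ne_zero.2 hGdet
  have hGN : G * (G⁻¹ * D) = D := Matrix.mul_nonsing_inv_cancel_left _ _ hu
  have hchar : (G⁻¹ * D).charpoly = Polynomial.X ^ 5 := by
    refine Polynomial.funext fun t => ?_
    rw [Matrix.eval_charpoly]
    have e : t • G - D = G * (Matrix.scalar (Fin 5) t - G⁻¹ * D) := by
      rw [Matrix.mul_sub, hGN]
      congr 1
      rw [Matrix.scalar_apply, ← Matrix.smul_one_eq_diagonal]
      simp
    have h := key t
    rw [e, Matrix.det_mul, Matrix.det_smul] at h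
    simp only [Fintype.card_fin] at h
    simp only [Polynomial.eval_pow, Polynomial.eval_X]
    apply mul_left_cancel₀ hGdet
    linarith
  have hN : (G⁻¹ * D) ^ 5 = 0 := by
    have := Matrix.aeval_self_charpoly (G⁻¹ * D)
    rwa [hchar, map_pow, Polynomial.aeval_X] at this
  exact no_nilpotent G (G⁻¹ * D) hGsymm (by rw [hGN, hD, kilMat_bracket]) hu hN
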